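/- arXiv:1705.04954 — 3 statements merged into one kernel-verified Lean document; each statement's English description precedes it below -/
import Mathlib

section
/- Let r > 1 be an integer and let G be a finite connected simple graph that is triangle-free (contains no induced subgraph isomorphic to K_3) and K_{1,r}-free (contains no induced subgraph isomorphic to the star K_{1,r}). Then the power of G satisfies π(G) ≤ r. -/
open SimpleGraph Finset

/-- `S` is a dominating set of `G`: every vertex is in `S` or adjacent to a vertex of `S`. -/
def IsDomSet {V : Type*} (G : SimpleGraph V) (S : Finset V) : Prop :=
  ∀ v : V, v ∈ S ∨ ∃ u ∈ S, G.Adj u v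

/-- The domination number of a finite graph. -/
noncomputable def domNum {V : Type*} [Fintype V] (G : SimpleGraph V) : ℕ :=
  sInf {n | ∃ S : Finset V, S.card = n ∧ IsDomSet G S}

/-- `G` is `H`-free: `G` has no induced subgraph isomorphic to `H`,
equivalently there is no graph embedding of `H` into `G`. -/
def IsFree {V W : Type*} (G : SimpleGraph V) (H : SimpleGraph W) : Prop :=
  ¬ Nonempty (H ↪g G)

/-- The allegiance of a dominating set `D`: the maximum over vertices `v` of
`|D ∩ N[v]|`, where `N[v]` is the closed neighborhood of `v`. -/
noncomputable def allegiance {V : Type*} [Fintype V] (G : SimpleGraph V) (D : Finset V) : ℕ :=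
  Finset.univ.sup fun v : V => ((D : Set V) ∩ insert v (G.neighborSet v)).ncard

/-- The power of a finite graph `G`: the minimum allegiance over all minimum
dominating sets (γ-sets) of `G`. -/
noncomputable def graphPower {V : Type*} [Fintype V] (G : SimpleGraph V) : ℕ :=
  sInf {a | ∃ D : Finset V, D.card = domNum G ∧ IsDomSet G D ∧ allegiance G D = a}

theorem not_adj_of_isFree_triangle {V : Type*} {G : SimpleGraph V}
    (h : IsFree G (⊤ : SimpleGraph (Fin 3))) {v a b : V}
    (ha : G.Adj v a) (hb : G.Adj v b) : ¬ G.Adj a b := by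
  intro hab
  classical
  have hclique : G.IsNClique 3 {v, a, b} := is3Clique_triple_iff.2 ⟨ha, hb, hab⟩
  exact h ⟨topEmbeddingOfNotCliqueFree fun hfree => hfree _ hclique⟩

/-- In a triangle-free graph without an induced `K_{1,r}`, every vertex has fewer than `r`
neighbors. -/
theorem ncard_neighborSet_lt {V : Type*} [Finite V] {G : SimpleGraph V} {r : ℕ}
    (htriangle : IsFree G (⊤ : SimpleGraph (Fin 3)))
    (hstar : IsFree G (completeBipartiteGraph (Fin 1) (Fin r))) (v : V) :
    (G.neighborSet v).ncard < r := by
  by_contra! hle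
  have : Fintype (G.neighborSet v) := Fintype.ofFinite _
  have hcard : Fintype.card (Fin r) ≤ Fintype.card (G.neighborSet v) := by
    rwa [Fintype.card_fin, ← Nat.card_eq_fintype_card]
  obtain ⟨f⟩ := Function.Embedding.nonempty_of_card_le hcard
  have hadj (i : Fin r) : G.Adj v (f i) := (f i).2
  refine hstar ⟨⟨⟨Sum.elim (fun _ => v) (fun i => (f i : V)), ?_⟩, ?_⟩⟩
  · rintro (a | a) (b | b) hab
    · rw [Subsingleton.elim a b]
    · exact absurd hab (hadj b).ne
    · exact absurd hab (hadj a).ne'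
    · exact congrArg Sum.inr (f.injective (Subtype.ext hab))
  · rintro (a | a) (b | b)
    · change G.Adj v v ↔ _
      simp
    · change G.Adj v (f b) ↔ _
      simpa using hadj b
    · change G.Adj (f a) v ↔ _
      simpa using (hadj a).symm
    · change G.Adj (f a) (f b) ↔ _
      simpa using not_adj_of_isFree_triangle htriangle (hadj a) (hadj b)

/-- Every finite graph has a minimum dominating set. -/
theorem exists_isDomSet_card_eq_domNum {V : Type*} [Fintype V] (G : SimpleGraph V) :
    ∃ D : Finset V, D.card = domNum G ∧ IsDomSet G D :=
  Nat.sInf_mem (s := {n | ∃ S : Finset V, S.card = n ∧ IsDomSet G S})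
    ⟨_, Finset.univ, rfl, fun v => Or.inl (Finset.mem_univ v)⟩

theorem allegiance_le {V : Type*} [Fintype V] {G : SimpleGraph V} {r : ℕ}
    (h : ∀ v, (G.neighborSet v).ncard < r) (D : Finset V) : allegiance G D ≤ r :=
  Finset.sup_le fun v _ =>
    calc ((D : Set V) ∩ insert v (G.neighborSet v)).ncard
        ≤ (insert v (G.neighborSet v)).ncard := Set.ncard_le_ncard Set.inter_subset_right
      _ ≤ (G.neighborSet v).ncard + 1 := Set.ncard_insert_le _ _
      _ ≤ r := h v

theorem stmt_0 {V : Type*} [Fintype V] (G : SimpleGraph V) (hconn : G.Connected)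
    (r : ℕ) (hr : 1 < r)
    (htriangle : IsFree G (⊤ : SimpleGraph (Fin 3)))
    (hstar : IsFree G (completeBipartiteGraph (Fin 1) (Fin r))) :
    graphPower G ≤ r := by
  obtain ⟨D, hcard, hdom⟩ := exists_isDomSet_card_eq_domNum G
  have hpower : graphPower G ≤ allegiance G D := Nat.sInf_le ⟨D, hcard, hdom, rfl⟩
  exact hpower.trans (allegiance_le (ncard_neighborSet_lt htriangle hstar) D)
end

section
/- Let r > 4 be an integer and let G be a finite connected simple graph that is K_r-free and P_5-free (contains no induced subgraph isomorphic to the complete graph K_r nor to the path on 5 vertices). Then the power of G satisfies π(G) ≤ r − 1. -/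
open SimpleGraph Finset

/-- The five vertices of an induced path in a `P₅`-free graph cannot exist; their distinctness
follows from the adjacencies. -/
theorem IsFree.no_induced_path_five {V : Type*} {G : SimpleGraph V}
    (h : IsFree G (pathGraph 5)) (p q s t w : V)
    (hpq : G.Adj p q) (hqs : G.Adj q s) (hst : G.Adj s t) (htw : G.Adj t w)
    (hps : ¬ G.Adj p s) (hpt : ¬ G.Adj p t) (hpw : ¬ G.Adj p w)
    (hqt : ¬ G.Adj q t) (hqw : ¬ G.Adj q w) (hsw : ¬ G.Adj s w) : False := by
  have hinj : Function.Injective ![p, q, s, t, w] := by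
    intro i j hij
    fin_cases i <;> fin_cases j <;> simp at hij ⊢ <;> subst hij <;>
      simp_all [G.adj_comm]
  refine h ⟨⟨⟨![p, q, s, t, w], hinj⟩, ?_⟩⟩
  intro i j
  fin_cases i <;> fin_cases j <;> simp [pathGraph_adj] <;>
    first | assumption | (rw [G.adj_comm]; assumption)

/-- A clique, or the vertex set of an induced path on three vertices. -/
def IsCliqueOrPathThree {V : Type*} (G : SimpleGraph V) (D : Finset V) : Prop :=
  G.IsClique D ∨
    ∃ a b c : V, G.Adj a b ∧ G.Adj b c ∧ ¬ G.Adj a c ∧ a ≠ c ∧ ∀ x, x ∈ D ↔ x = a ∨ x = b ∨ x = c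

/-- `v` lies in the closed neighborhood of `D`. -/
def Dominates {V : Type*} (G : SimpleGraph V) (D : Finset V) (v : V) : Prop :=
  v ∈ D ∨ ∃ u ∈ D, G.Adj u v

theorem exists_dominates_of_isClique {V : Type*} {G : SimpleGraph V}
    (hP5 : IsFree G (pathGraph 5)) {K : Finset V} (hK : G.IsClique K) {u v : V}
    (hv : ¬ Dominates G K v) (huv : G.Adj u v) (hu : Dominates G K u) :
    ∃ D, IsCliqueOrPathThree G D ∧ Dominates G D v ∧ ∀ z, Dominates G K z → Dominates G D z := by
  classical
  have hP := hP5.no_induced_path_five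
  have hK' : ∀ x ∈ K, ∀ y ∈ K, x ≠ y → G.Adj x y := fun x hx y hy => hK hx hy
  have hvK : ∀ x ∈ K, ¬ G.Adj v x := fun x hx h => hv (.inr ⟨x, hx, h.symm⟩)
  have huK : u ∉ K := fun h => hvK u h huv.symm
  obtain ⟨k, hk, hku⟩ := hu.resolve_left huK
  by_cases hQ : ∀ z, Dominates G K z → Dominates G (insert u (K.filter (G.Adj u))) z
  · refine ⟨insert u (K.filter (G.Adj u)), .inl ?_, .inr ⟨u, by simp, huv⟩, hQ⟩
    rw [coe_insert, isClique_insert]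
    refine ⟨hK.subset (coe_subset.2 (filter_subset _ _)), fun b hb _ => (mem_filter.1 hb).2⟩
  · push Not at hQ
    obtain ⟨w, hwK, hwQ⟩ := hQ
    have hwu : ¬ G.Adj u w := fun h => hwQ (.inr ⟨u, by simp, h⟩)
    have hwku : ∀ x ∈ K, G.Adj u x → ¬ G.Adj x w := fun x hx hux h =>
      hwQ (.inr ⟨x, by simp [hx, hux], h⟩)
    have hw_notMem : w ∉ K := by
      intro h
      by_cases hwk : k = w
      · subst hwk; exact hwu hku.symm
      · exact hwku k hk hku.symm (hK' k hk w h hwk)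
    obtain ⟨l, hl, hlw⟩ := hwK.resolve_left hw_notMem
    have hul : ¬ G.Adj u l := fun h => hwku l hl h hlw
    have hkl : G.Adj k l := hK' k hk l hl (by rintro rfl; exact hul hku.symm)
    have hvw : G.Adj v w := by
      by_contra h
      exact hP v u k l w huv.symm hku.symm hkl hlw (hvK k hk) (hvK l hl) h hul hwu
        (hwku k hk hku.symm)
    refine ⟨{v, u, k}, .inr ⟨v, u, k, huv.symm, hku.symm, hvK k hk, ?_, by simp⟩,
      .inl (by simp), ?_⟩
    · rintro rfl; exact hv (.inl hk)
    intro z hz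
    by_contra hzD
    have hzv : ¬ G.Adj v z := fun h => hzD (.inr ⟨v, by simp, h⟩)
    have hzu : ¬ G.Adj u z := fun h => hzD (.inr ⟨u, by simp, h⟩)
    have hzk : ¬ G.Adj k z := fun h => hzD (.inr ⟨k, by simp, h⟩)
    have hzK : z ∉ K := fun h => hzk (hK' k hk z h (by rintro rfl; exact hzD (.inl (by simp))))
    obtain ⟨x, hx, hxz⟩ := hz.resolve_left hzK
    have hkx : G.Adj k x := hK' k hk x hx (by rintro rfl; exact hzk hxz)
    have hux : G.Adj u x := by
      by_contra h
      exact hP v u k x z huv.symm hku.symm hkx hxz (hvK k hk) (hvK x hx) hzv h hzu hzk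
    have hlx : G.Adj l x := hK' l hl x hx (by rintro rfl; exact hul hux)
    have hwz : ¬ G.Adj w z := fun h =>
      hP k u v w z hku huv hvw h (fun h => hvK k hk h.symm) (hwku k hk hku.symm) hzk hwu hzu hzv
    have hlz : G.Adj l z := by
      by_contra h
      exact hP v w l x z hvw hlw.symm hlx hxz (hvK l hl) (hvK x hx) hzv
        (fun h => hwku x hx hux h.symm) hwz h
    exact hP v u k l z huv.symm hku.symm hkl hlz (hvK k hk) (hvK l hl) hzv hul hzu hzk

theorem exists_dominates_of_path_three {V : Type*} {G : SimpleGraph V}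
    (hP5 : IsFree G (pathGraph 5)) {a b c : V} (hab : G.Adj a b) (hbc : G.Adj b c)
    (hac : ¬ G.Adj a c) (hne : a ≠ c) {T : Finset V} (hT : ∀ x, x ∈ T ↔ x = a ∨ x = b ∨ x = c)
    {u v : V} (hv : ¬ Dominates G T v) (huv : G.Adj u v) (hu : Dominates G T u) :
    ∃ D, IsCliqueOrPathThree G D ∧ Dominates G D v ∧ ∀ z, Dominates G T z → Dominates G D z := by
  classical
  have hP := hP5.no_induced_path_five
  have hdom : ∀ z, Dominates G T z ↔ (z = a ∨ z = b ∨ z = c) ∨ G.Adj a z ∨ G.Adj b z ∨ G.Adj c z := by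
    intro z; simp [Dominates, hT]
  have htri : ∀ x y t z, Dominates G ({x, y, t} : Finset V) z ↔
      (z = x ∨ z = y ∨ z = t) ∨ G.Adj x z ∨ G.Adj y z ∨ G.Adj t z := by
    intro x y t z; simp [Dominates]
  have hclique : ∀ x y t, G.Adj x y → G.Adj y t → G.Adj x t →
      IsCliqueOrPathThree G ({x, y, t} : Finset V) := by
    intro x y t h1 h2 h3
    left
    simp [IsClique, Set.pairwise_insert, h1, h2, h3, h1.symm, h2.symm, h3.symm]
  have hpath : ∀ x y t, G.Adj x y → G.Adj y t → ¬ G.Adj x t → x ≠ t →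
      IsCliqueOrPathThree G ({x, y, t} : Finset V) := by
    intro x y t h1 h2 h3 h4
    exact .inr ⟨x, y, t, h1, h2, h3, h4, by simp⟩
  simp only [hdom, not_or] at hv hu
  obtain ⟨⟨hva, hvb, hvc⟩, hav, hbv, hcv⟩ := hv
  have hA : ∀ w, G.Adj w v → ((w = a ∨ w = b ∨ w = c) ∨ G.Adj a w ∨ G.Adj b w ∨ G.Adj c w) →
      G.Adj b w ∨ (G.Adj a w ∧ G.Adj c w) := by
    intro w hwv hw
    have h1 := hP v w a b c
    have h2 := hP v w c b a
    clear hP hpath hclique hdom htri hT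
    grind [G.adj_comm]
  have hext : ∀ w x y z, G.Adj w v → G.Adj x w → G.Adj x y → G.Adj y z → ¬ G.Adj x v →
      ¬ G.Adj y v → ¬ G.Adj y w → G.Adj v z ∨ G.Adj w z ∨ G.Adj x z := by
    intro w x y z hwv hxw hxy hyz hxv hyv hyw
    by_contra! h
    exact hP v w x y z hwv.symm hxw.symm hxy hyz (fun h => hxv h.symm) (fun h => hyv h.symm) h.1
      (fun h => hyw h.symm) h.2.1 h.2.2
  by_cases hb : ∃ w, G.Adj w v ∧ G.Adj b w ∧ ¬ G.Adj a w ∧ ¬ G.Adj c w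
  · obtain ⟨w, hwv, hbw, haw, hcw⟩ := hb
    refine ⟨{v, w, b}, hpath v w b hwv.symm hbw.symm (fun h => hbv h.symm) hvb,
      (htri v w b v).2 (.inl (.inl rfl)), fun z => ?_⟩
    rw [hdom, htri]
    have h1 := hext w b a z hwv hbw hab.symm
    have h2 := hext w b c z hwv hbw hbc
    have h3 := hab.symm
    clear hP hpath hclique hdom htri hT hA hext
    grind
  have huA := hA u huv hu
  by_cases hub : G.Adj b u
  · by_cases hQa : G.Adj a u ∧ ∀ z, Dominates G T z → Dominates G {u, a, b} z
    · exact ⟨{u, a, b}, hclique u a b hQa.1.symm hab hub.symm,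
        (htri u a b v).2 (.inr (.inl huv)), hQa.2⟩
    by_cases hQc : G.Adj c u ∧ ∀ z, Dominates G T z → Dominates G {u, c, b} z
    · exact ⟨{u, c, b}, hclique u c b hQc.1.symm hbc.symm hub.symm,
        (htri u c b v).2 (.inr (.inl huv)), hQc.2⟩
    rw [not_and] at hQa hQc
    have hau : G.Adj a u := by
      by_contra hau
      refine hQc (by_contra fun hcu => hb ⟨u, huv, hub, hau, hcu⟩) fun z => ?_
      rw [hdom, htri]
      have h1 := hext u b a z huv hub hab.symm
      have h2 := hA z
      have h3 := G.adj_comm v z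
      have h4 := hab.symm
      clear hP hpath hclique hdom htri hT hA hext hQa hQc hb
      grind
    have hcu : G.Adj c u := by
      by_contra hcu
      refine hQa hau fun z => ?_
      rw [hdom, htri]
      have h1 := hext u b c z huv hub hbc
      have h2 := hA z
      have h3 := G.adj_comm v z
      clear hP hpath hclique hdom htri hT hA hext hQa hQc hb
      grind
    have hQa := hQa hau
    have hQc := hQc hcu
    push Not at hQa hQc
    obtain ⟨z, hz, hzQ⟩ := hQa
    obtain ⟨y, hy, hyQ⟩ := hQc
    rw [hdom] at hz hy
    rw [htri] at hzQ hyQ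
    have h1 := hA z
    have h2 := hA y
    have h3 := hP y a b c z
    have h4 := hP v u a y z
    clear hP hpath hclique hdom htri hT hA hext hb
    grind [G.adj_comm]
  · refine ⟨{a, u, c}, hpath a u c (by tauto) (by rw [G.adj_comm]; tauto) hac hne,
      (htri a u c v).2 (.inr (.inr (.inl huv))), fun z => ?_⟩
    rw [hdom, htri]
    have h0 := fun h => hb ⟨z, h⟩
    have h1 := hext u a b z huv
    have h2 := hA z
    have h3 := G.adj_comm v z
    have h4 := hbc.symm
    clear hP hpath hclique hdom htri hT hA hext hb
    grind

theorem exists_dominates_all {V : Type*} [Fintype V] {G : SimpleGraph V} (hconn : G.Connected)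
    (hP5 : IsFree G (pathGraph 5)) :
    ∃ D, IsCliqueOrPathThree G D ∧ ∀ z, Dominates G D z := by
  classical
  obtain ⟨D, hD, hmax⟩ := Set.exists_max_image {D | IsCliqueOrPathThree G D}
    (fun D => (univ.filter (Dominates G D)).card) (Set.toFinite _) ⟨∅, .inl (by simp)⟩
  refine ⟨D, hD, ?_⟩
  by_contra! hz
  obtain ⟨x, hx⟩ := hz
  have hstep : ∃ D', IsCliqueOrPathThree G D' ∧ (∃ v, Dominates G D' v ∧ ¬ Dominates G D v) ∧
      ∀ z, Dominates G D z → Dominates G D' z := by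
    by_cases hne : ∃ y, Dominates G D y
    · obtain ⟨y, hy⟩ := hne
      obtain ⟨u, v, huv, hu, hv⟩ : ∃ u v, G.Adj u v ∧ Dominates G D u ∧ ¬ Dominates G D v := by
        by_contra! h
        have hw : ∀ {p q : V}, G.Walk p q → Dominates G D p → Dominates G D q := by
          intro p q w
          induction w with
          | nil => exact id
          | cons hpq _ ih => exact fun hp => ih (h _ _ hpq hp)
        obtain ⟨w⟩ := hconn.preconnected y x
        exact hx (hw w hy)
      obtain hK | ⟨a, b, c, hab, hbc, hac, hne, hT⟩ := hD
      · obtain ⟨D', h1, h2, h3⟩ := exists_dominates_of_isClique hP5 hK hv huv hu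
        exact ⟨D', h1, ⟨v, h2, hv⟩, h3⟩
      · obtain ⟨D', h1, h2, h3⟩ := exists_dominates_of_path_three hP5 hab hbc hac hne hT hv huv hu
        exact ⟨D', h1, ⟨v, h2, hv⟩, h3⟩
    · exact ⟨{x}, .inl (by simp), ⟨x, .inl (by simp), hx⟩, fun z hz => (hne ⟨z, hz⟩).elim⟩
  obtain ⟨D', hD', ⟨v, hv', hv⟩, hle⟩ := hstep
  refine (hmax D' hD').not_gt (card_lt_card ⟨fun z => ?_, fun h => hv ?_⟩)
  · simpa using hle z
  · simpa using h (by simpa using hv')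

theorem stmt_3 {V : Type*} [Fintype V] (G : SimpleGraph V) (hconn : G.Connected)
    (r : ℕ) (hr : 4 < r)
    (hKr : IsFree G (⊤ : SimpleGraph (Fin r)))
    (hP5 : IsFree G (pathGraph 5)) :
    graphPower G ≤ r - 1 := by
  classical
  obtain ⟨D, hD, hdom⟩ := exists_dominates_all hconn hP5
  have hcard : D.card ≤ r - 1 := by
    obtain hK | ⟨a, b, c, -, -, -, -, hT⟩ := hD
    · by_contra! h
      obtain ⟨K, hKD, hKr'⟩ := exists_subset_card_eq (show r ≤ D.card by omega)
      have hfree : ¬ G.CliqueFree r := fun hfree => hfree K ⟨hK.subset (by simpa), hKr'⟩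
      exact hKr ⟨topEmbeddingOfNotCliqueFree hfree⟩
    · have : D = {a, b, c} := by ext x; simp [hT]
      have := card_le_three (a := a) (b := b) (c := c)
      subst D
      omega
  have hne : {n | ∃ S : Finset V, S.card = n ∧ IsDomSet G S}.Nonempty := ⟨_, D, rfl, hdom⟩
  obtain ⟨S, hS, hSdom⟩ := Nat.sInf_mem hne
  have hγ : domNum G ≤ D.card := Nat.sInf_le ⟨D, rfl, hdom⟩
  have hpow : graphPower G ≤ allegiance G S := Nat.sInf_le ⟨S, hS, hSdom, rfl⟩
  have hall : allegiance G S ≤ S.card := Finset.sup_le fun v _ => by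
    rw [← Set.ncard_coe_finset S]
    exact Set.ncard_le_ncard Set.inter_subset_left (S.finite_toSet)
  have : S.card = domNum G := hS
  omega
end

section
/- Let r > 1 be an integer and let G be a finite connected simple graph that is triangle-free and K_{1,r}-free (contains no induced subgraph isomorphic to K_3 nor to the star K_{1,r}). Then for every finite simple graph H, γ(G □ H) ≥ (r/(2r−1))·γ(G)·γ(H). -/
open SimpleGraph Finset

/-- A set attaining the domination number. -/
theorem exists_isDomSet_card_eq {V : Type*} [Fintype V] (G : SimpleGraph V) :
    ∃ S : Finset V, S.card = domNum G ∧ IsDomSet G S :=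
  Nat.sInf_mem (s := {n | ∃ S : Finset V, S.card = n ∧ IsDomSet G S})
    ⟨_, Finset.univ, rfl, fun v => Or.inl (Finset.mem_univ v)⟩

theorem domNum_le_card {V : Type*} [Fintype V] {G : SimpleGraph V} {S : Finset V}
    (hS : IsDomSet G S) : domNum G ≤ S.card :=
  Nat.sInf_le ⟨S, rfl, hS⟩

open scoped Classical in
/-- A triangle-free, `K_{1,r}`-free graph has maximum degree less than `r`. -/
theorem card_neighbors_lt_of_isFree {V : Type*} [Fintype V] {G : SimpleGraph V} {r : ℕ}
    (htriangle : IsFree G (⊤ : SimpleGraph (Fin 3)))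
    (hstar : IsFree G (completeBipartiteGraph (Fin 1) (Fin r))) (v : V) :
    (Finset.univ.filter (G.Adj v)).card < r := by
  by_contra! hcard
  have htri : ∀ a b, G.Adj v a → G.Adj v b → ¬ G.Adj a b := by
    have hfree : G.CliqueFree 3 := by
      by_contra h
      exact htriangle ⟨topEmbeddingOfNotCliqueFree h⟩
    intro a b ha hb hab
    exact hfree {v, a, b} (is3Clique_triple_iff.mpr ⟨ha, hb, hab⟩)
  obtain ⟨f⟩ : Nonempty (Fin r ↪ {x // x ∈ Finset.univ.filter (G.Adj v)}) :=
    Function.Embedding.nonempty_of_card_le (by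
      rwa [Fintype.card_fin, Fintype.card_coe])
  have hf : ∀ k, G.Adj v (f k) := fun k => (Finset.mem_filter.mp (f k).2).2
  refine hstar ⟨⟨⟨Sum.elim (fun _ => v) (fun k => (f k : V)), ?_⟩, ?_⟩⟩
  · rintro (a | a) (b | b) h
    · exact congrArg _ (Subsingleton.elim _ _)
    · exact absurd h (hf b).ne
    · exact absurd h (hf a).ne'
    · exact congrArg _ (f.injective (Subtype.ext h))
  · rintro (a | a) (b | b)
    · change G.Adj v v ↔ _
      simp
    · change G.Adj v (f b) ↔ _
      simp [hf]
    · change G.Adj (f a) v ↔ _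
      simp [(hf _).symm]
    · change G.Adj (f a) (f b) ↔ _
      simp [htri _ _ (hf a) (hf b)]

section Labelling

variable {V W : Type*}

open scoped Classical in
/-- The labels available to a vertex `v`: itself if `v ∈ U`, otherwise its neighbours in `U`. -/
noncomputable def labels (G : SimpleGraph V) (U : Finset V) (v : V) : Finset V :=
  if v ∈ U then {v} else U.filter (G.Adj v)

open scoped Classical in
/-- The labels occurring in `D` on the layers adjacent to the layer of `w`. -/
noncomputable def verticalLabels (H : SimpleGraph W) (U : Finset V) (D : Finset (V × W))
    (l : V × W → V) (w : W) : Finset V :=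
  U.filter fun u => ∃ v w', (v, w') ∈ D ∧ H.Adj w' w ∧ l (v, w') = u

open scoped Classical in
/-- The labels occurring in `D` neither on the layer of `w` nor on an adjacent layer. -/
noncomputable def missingLabels (H : SimpleGraph W) (U : Finset V) (D : Finset (V × W))
    (l : V × W → V) (w : W) : Finset V :=
  U.filter fun u => u ∉ verticalLabels H U D l w ∧ ∀ v, (v, w) ∈ D → l (v, w) ≠ u

variable {G : SimpleGraph V} {H : SimpleGraph W} {U : Finset V} {D : Finset (V × W)}
  {l : V × W → V}

theorem labels_of_mem {v : V} (hv : v ∈ U) : labels G U v = {v} :=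
  if_pos hv

open scoped Classical in
theorem mem_labels_of_notMem {u v : V} (hv : v ∉ U) :
    u ∈ labels G U v ↔ u ∈ U ∧ G.Adj v u := by
  rw [labels, if_neg hv, Finset.mem_filter]

open scoped Classical in
theorem mem_verticalLabels {u : V} {w : W} : u ∈ verticalLabels H U D l w ↔
    u ∈ U ∧ ∃ v w', (v, w') ∈ D ∧ H.Adj w' w ∧ l (v, w') = u := by
  rw [verticalLabels, Finset.mem_filter]

open scoped Classical in
theorem mem_missingLabels {u : V} {w : W} : u ∈ missingLabels H U D l w ↔
    u ∈ U ∧ u ∉ verticalLabels H U D l w ∧ ∀ v, (v, w) ∈ D → l (v, w) ≠ u := by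
  rw [missingLabels, Finset.mem_filter]

theorem verticalLabels_subset (w : W) : verticalLabels H U D l w ⊆ U :=
  fun _ hu => (mem_verticalLabels.mp hu).1

theorem eq_of_mem_labels {u v : V} (hv : v ∈ U) (h : u ∈ labels G U v) : u = v := by
  rwa [labels_of_mem hv, Finset.mem_singleton] at h

theorem mem_of_mem_labels {u v : V} (h : u ∈ labels G U v) : u ∈ U := by
  by_cases hv : v ∈ U
  · exact eq_of_mem_labels hv h ▸ hv
  · exact ((mem_labels_of_notMem hv).mp h).1

theorem eq_or_adj_of_mem_labels {u v : V} (h : u ∈ labels G U v) : u = v ∨ G.Adj u v := by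
  by_cases hv : v ∈ U
  · exact Or.inl (eq_of_mem_labels hv h)
  · exact Or.inr ((mem_labels_of_notMem hv).mp h).2.symm

theorem labels_nonempty (hU : IsDomSet G U) (v : V) : (labels G U v).Nonempty := by
  by_cases hv : v ∈ U
  · exact labels_of_mem (G := G) hv ▸ Finset.singleton_nonempty v
  · obtain ⟨u, hu, huv⟩ := (hU v).resolve_left hv
    exact ⟨u, (mem_labels_of_notMem hv).mpr ⟨hu, huv.symm⟩⟩

theorem label_mem_verticalLabels (hl : ∀ p, l p ∈ labels G U p.1) {v : V} {w w' : W}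
    (hD : (v, w') ∈ D) (hw : H.Adj w' w) : l (v, w') ∈ verticalLabels H U D l w :=
  mem_verticalLabels.mpr ⟨mem_of_mem_labels (hl _), v, w', hD, hw, rfl⟩

open scoped Classical in
theorem domNum_mul_card_le [Fintype W] (hl : ∀ p, l p ∈ labels G U p.1) :
    U.card * domNum H ≤ D.card + ∑ w, (missingLabels H U D l w).card := by
  have hu : ∀ u ∈ U, domNum H ≤ (D.filter fun p => l p = u).card +
      (Finset.univ.filter fun w => u ∈ missingLabels H U D l w).card := by
    intro u hu
    refine (domNum_le_card (S := (D.filter fun p => l p = u).image Prod.snd ∪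
      Finset.univ.filter fun w => u ∈ missingLabels H U D l w) fun w => ?_).trans
      ((Finset.card_union_le _ _).trans (Nat.add_le_add_right Finset.card_image_le _))
    by_cases h1 : u ∈ missingLabels H U D l w
    · exact Or.inl (by simp [h1])
    · simp only [mem_missingLabels, hu, true_and, not_and_or, not_not,
        not_forall] at h1
      obtain h1 | ⟨v, hv, h1⟩ := h1
      · obtain ⟨-, v, w', hD, hw, h⟩ := mem_verticalLabels.mp h1
        exact Or.inr ⟨w', Finset.mem_union_left _ (Finset.mem_image.mpr
          ⟨(v, w'), Finset.mem_filter.mpr ⟨hD, h⟩, rfl⟩), hw⟩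
      · exact Or.inl (Finset.mem_union_left _ (Finset.mem_image.mpr
          ⟨(v, w), Finset.mem_filter.mpr ⟨hv, h1⟩, rfl⟩))
  have h := Finset.sum_le_sum hu
  rw [Finset.sum_const, smul_eq_mul, Finset.sum_add_distrib,
    ← Finset.card_eq_sum_card_fiberwise (fun p _ => mem_of_mem_labels (hl p))] at h
  refine h.trans (Nat.add_le_add_left (le_of_eq ?_) _)
  have hM : ∀ w, (missingLabels H U D l w).card =
      (U.filter fun u => u ∈ missingLabels H U D l w).card := fun w => by
    congr 1
    ext u
    simp only [Finset.mem_filter, iff_and_self]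
    exact fun hu => (mem_missingLabels.mp hu).1
  simp_rw [hM]
  exact Finset.sum_card_bipartiteAbove_eq_sum_card_bipartiteBelow
    (fun u w => u ∈ missingLabels H U D l w)

open scoped Classical in
/-- A layer of `D` together with the labels on adjacent layers dominates `G`. -/
theorem isDomSet_layer_union_verticalLabels [Fintype V] (hD : IsDomSet (G □ H) D)
    (hl : ∀ p, l p ∈ labels G U p.1) (w : W) :
    IsDomSet G ((Finset.univ.filter fun v => (v, w) ∈ D) ∪ verticalLabels H U D l w) := by
  intro v
  rcases hD (v, w) with h | ⟨⟨v', w'⟩, h, hadj⟩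
  · exact Or.inl (by simp [h])
  · rcases boxProd_adj.mp hadj with ⟨h1, h2⟩ | ⟨h1, h2⟩
    · obtain rfl : w' = w := h2
      exact Or.inr ⟨v', by simp [h], h1⟩
    · obtain rfl : v' = v := h2
      have hmem := Finset.mem_union_right (Finset.univ.filter fun v => (v, w) ∈ D)
        (label_mem_verticalLabels hl h h1)
      rcases eq_or_adj_of_mem_labels (hl (v', w')) with he | he
      · rw [he] at hmem
        exact Or.inl hmem
      · exact Or.inr ⟨_, hmem, he⟩

open scoped Classical in
/-- The vertical labels of a layer do not depend on the labels within this layer. -/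
theorem verticalLabels_update {v u : V} {w : W} :
    verticalLabels H U D (Function.update l (v, w) u) w = verticalLabels H U D l w := by
  ext x
  simp only [mem_verticalLabels]
  refine and_congr_right fun _ => exists_congr fun v' => exists_congr fun w' =>
    and_congr_right fun _ => and_congr_right fun hw => ?_
  rw [Function.update_of_ne fun h => hw.ne (congrArg Prod.snd h)]

open scoped Classical in
/-- Changing the label of `(v, w)` shows that a given label is attained on the layer of `w` in a
proportion at least `1 / m` of the labellings. -/
theorem card_filter_notMem_verticalLabels_le [Fintype V] [Fintype W] {m : ℕ} {v u : V} {w : W}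
    (hm : (labels G U v).card ≤ m) (hvw : (v, w) ∈ D) (hu : u ∈ labels G U v) :
    ((Fintype.piFinset fun p : V × W => labels G U p.1).filter
        fun l => u ∉ verticalLabels H U D l w).card ≤
      m * ((Fintype.piFinset fun p : V × W => labels G U p.1).filter
        fun l => u ∉ verticalLabels H U D l w ∧ ∃ v, (v, w) ∈ D ∧ l (v, w) = u).card := by
  refine Finset.card_le_mul_card_image_of_maps_to (f := fun l => Function.update l (v, w) u) ?_ m ?_
  · intro l hl
    simp only [Finset.mem_filter, Fintype.mem_piFinset] at hl ⊢
    refine ⟨fun p => ?_, ?_, v, hvw, by simp⟩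
    · by_cases hp : p = (v, w)
      · subst hp
        simpa using hu
      · rw [Function.update_of_ne hp]
        exact hl.1 p
    · rw [verticalLabels_update]
      exact hl.2
  · intro l' _
    refine le_trans (Finset.card_le_card_of_injOn (fun l => l (v, w)) ?_ ?_) hm
    · intro l hl
      simp only [Finset.mem_coe, Finset.mem_filter, Fintype.mem_piFinset] at hl
      exact hl.1.1 (v, w)
    · intro l₁ h₁ l₂ h₂ h
      simp only [Finset.mem_coe, Finset.mem_filter] at h₁ h₂
      have he := h₁.2.trans h₂.2.symm
      funext p
      by_cases hp : p = (v, w)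
      · exact hp ▸ h
      · simpa [Function.update_of_ne hp] using congrFun he p

open scoped Classical in
/-- The average number of missing labels on a layer, over all labellings. -/
theorem sum_card_missingLabels_le [Fintype V] [Fintype W] {m : ℕ} (hm : 1 ≤ m)
    (hdeg : ∀ v, (Finset.univ.filter (G.Adj v)).card ≤ m) (hUcard : U.card = domNum G)
    (hD : IsDomSet (G □ H) D) (w : W) :
    (m + 1) * ∑ l ∈ Fintype.piFinset fun p : V × W => labels G U p.1,
        (missingLabels H U D l w).card ≤
      m * ((Fintype.piFinset fun p : V × W => labels G U p.1).card *
        (Finset.univ.filter fun v => (v, w) ∈ D).card) := by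
  set Λ := Fintype.piFinset fun p : V × W => labels G U p.1 with hΛ
  set L := Finset.univ.filter fun v => (v, w) ∈ D with hL
  set A := U ∩ L with hA
  set C := (U \ A).filter fun u => ∃ v ∈ L, v ∉ U ∧ G.Adj v u with hC
  set B := ((U \ A) \ C).filter fun u => ∃ v ∈ A, G.Adj v u with hB
  have hΛl : ∀ l ∈ Λ, ∀ p, l p ∈ labels G U p.1 := fun l hl => Fintype.mem_piFinset.mp hl
  have hlab : ∀ v ∉ U, (labels G U v).card ≤ m := fun v hv => by
    refine (Finset.card_le_card fun u hu => ?_).trans (hdeg v)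
    simpa using ((mem_labels_of_notMem hv).mp hu).2
  have hBcard : B.card ≤ m * A.card := by
    have hsub : B ⊆ A.biUnion fun v => Finset.univ.filter (G.Adj v) := fun u hu => by
      obtain ⟨v, hv, hvu⟩ := (Finset.mem_filter.mp hu).2
      exact Finset.mem_biUnion.mpr ⟨v, hv, by simpa using hvu⟩
    rw [mul_comm]
    exact (Finset.card_le_card hsub).trans (Finset.card_biUnion_le_card_mul _ _ _ fun v _ => hdeg v)
  have hBC : Disjoint B C := Finset.disjoint_left.mpr fun u hu =>
    (Finset.mem_sdiff.mp (Finset.mem_filter.mp hu).1).2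
  have hBU : B ⊆ U \ A := (Finset.filter_subset _ _).trans Finset.sdiff_subset
  have hCU : C ⊆ U \ A := Finset.filter_subset _ _
  -- The unlabelled part of the dominating set is no larger than the layer.
  have hlayer : ∀ l ∈ Λ, (B \ verticalLabels H U D l w).card +
      (C \ verticalLabels H U D l w).card + A.card ≤ L.card := by
    intro l hl
    set T := verticalLabels H U D l w
    have h1 : U.card ≤ (L ∪ T).card :=
      hUcard ▸ domNum_le_card (isDomSet_layer_union_verticalLabels hD (hΛl l hl) w)
    have hTU : T ⊆ U := verticalLabels_subset w
    have h2 : L ∪ T ⊆ L ∪ (T \ A) := fun x => by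
      simp only [Finset.mem_union, Finset.mem_sdiff, hA, Finset.mem_inter]
      tauto
    have h3 := (h1.trans (Finset.card_le_card h2)).trans (Finset.card_union_le _ _)
    have h4 : (B \ T) ∪ (C \ T) ∪ A ∪ (T \ A) ⊆ U :=
      Finset.union_subset (Finset.union_subset (Finset.union_subset
        (Finset.sdiff_subset.trans (hBU.trans Finset.sdiff_subset))
        (Finset.sdiff_subset.trans (hCU.trans Finset.sdiff_subset))) Finset.inter_subset_left)
        (Finset.sdiff_subset.trans hTU)
    have h5 := Finset.card_le_card h4
    rw [Finset.card_union_of_disjoint, Finset.card_union_of_disjoint,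
      Finset.card_union_of_disjoint] at h5
    · omega
    · exact hBC.mono Finset.sdiff_subset Finset.sdiff_subset
    · refine Finset.disjoint_left.mpr fun x hx hxA => ?_
      rcases Finset.mem_union.mp hx with h | h
      · exact (Finset.mem_sdiff.mp (hBU (Finset.mem_sdiff.mp h).1)).2 hxA
      · exact (Finset.mem_sdiff.mp (hCU (Finset.mem_sdiff.mp h).1)).2 hxA
    · refine Finset.disjoint_left.mpr fun x hx hxT => ?_
      simp only [Finset.mem_union, Finset.mem_sdiff] at hx hxT
      tauto
  have hmiss : ∀ l ∈ Λ, (missingLabels H U D l w).card +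
      (C.filter fun u => u ∉ verticalLabels H U D l w ∧ ∃ v, (v, w) ∈ D ∧ l (v, w) = u).card ≤
      (B \ verticalLabels H U D l w).card + (C \ verticalLabels H U D l w).card := by
    intro l hl
    rw [← Finset.card_union_of_disjoint, ← Finset.card_union_of_disjoint]
    · refine Finset.card_le_card fun u hu => ?_
      rcases Finset.mem_union.mp hu with hu | hu
      · obtain ⟨huU, huT, hun⟩ := mem_missingLabels.mp hu
        have huA : u ∉ A := fun h => by
          have huD : (u, w) ∈ D := by simpa [hL] using (Finset.mem_inter.mp h).2
          exact hun u huD (eq_of_mem_labels huU (hΛl l hl (u, w)))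
        by_cases huC : u ∈ C
        · exact Finset.mem_union_right _ (Finset.mem_sdiff.mpr ⟨huC, huT⟩)
        refine Finset.mem_union_left _ (Finset.mem_sdiff.mpr ⟨Finset.mem_filter.mpr
          ⟨Finset.mem_sdiff.mpr ⟨Finset.mem_sdiff.mpr ⟨huU, huA⟩, huC⟩, ?_⟩, huT⟩)
        rcases hD (u, w) with h | ⟨⟨v', w'⟩, h, hadj⟩
        · exact absurd (Finset.mem_inter.mpr ⟨huU, by simpa [hL] using h⟩) huA
        · rcases boxProd_adj.mp hadj with ⟨h1, h2⟩ | ⟨h1, h2⟩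
          · obtain rfl : w' = w := h2
            have hv'L : v' ∈ L := by simpa [hL] using h
            by_cases hv' : v' ∈ U
            · exact ⟨v', Finset.mem_inter.mpr ⟨hv', hv'L⟩, h1⟩
            · exact absurd (Finset.mem_filter.mpr ⟨Finset.mem_sdiff.mpr ⟨huU, huA⟩,
                v', hv'L, hv', h1⟩) huC
          · obtain rfl : v' = u := h2
            have := label_mem_verticalLabels (hΛl l hl) h h1
            rw [eq_of_mem_labels huU (hΛl l hl (v', w'))] at this
            exact absurd this huT
      · obtain ⟨huC, huT, -⟩ := Finset.mem_filter.mp hu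
        exact Finset.mem_union_right _ (Finset.mem_sdiff.mpr ⟨huC, huT⟩)
    · exact hBC.mono Finset.sdiff_subset Finset.sdiff_subset
    · refine Finset.disjoint_left.mpr fun u hu hu' => ?_
      obtain ⟨v, hv, hvu⟩ := (Finset.mem_filter.mp hu').2.2
      exact (mem_missingLabels.mp hu).2.2 v hv hvu
  have hswap : ∑ l ∈ Λ, (C \ verticalLabels H U D l w).card ≤ m * ∑ l ∈ Λ,
      (C.filter fun u => u ∉ verticalLabels H U D l w ∧ ∃ v, (v, w) ∈ D ∧ l (v, w) = u).card := by
    simp_rw [Finset.sdiff_eq_filter]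
    have h1 := Finset.sum_card_bipartiteAbove_eq_sum_card_bipartiteBelow (s := Λ) (t := C)
      (fun l u => u ∉ verticalLabels H U D l w)
    have h2 := Finset.sum_card_bipartiteAbove_eq_sum_card_bipartiteBelow (s := Λ) (t := C)
      (fun l u => u ∉ verticalLabels H U D l w ∧ ∃ v, (v, w) ∈ D ∧ l (v, w) = u)
    simp only [Finset.bipartiteAbove, Finset.bipartiteBelow] at h1 h2
    rw [h1, h2, Finset.mul_sum]
    refine Finset.sum_le_sum fun u hu => ?_
    obtain ⟨huU, v, hv, hvU, hvu⟩ := Finset.mem_filter.mp hu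
    refine card_filter_notMem_verticalLabels_le (hlab v hvU) (by simpa [hL] using hv) ?_
    exact (mem_labels_of_notMem hvU).mpr ⟨(Finset.mem_sdiff.mp huU).1, hvu⟩
  have hsumB : ∑ l ∈ Λ, (B \ verticalLabels H U D l w).card ≤ Λ.card * (m * A.card) := by
    rw [← smul_eq_mul]
    exact Finset.sum_le_card_nsmul _ _ _ fun l _ =>
      (Finset.card_le_card Finset.sdiff_subset).trans hBcard
  have hsumlayer := Finset.sum_le_sum hlayer
  have hsummiss := Finset.sum_le_sum hmiss
  simp only [Finset.sum_add_distrib, Finset.sum_const, smul_eq_mul] at hsumlayer hsummiss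
  generalize ∑ l ∈ Λ, (missingLabels H U D l w).card = s at *
  generalize ∑ l ∈ Λ, (B \ verticalLabels H U D l w).card = b at *
  generalize ∑ l ∈ Λ, (C \ verticalLabels H U D l w).card = c at *
  generalize ∑ l ∈ Λ, (C.filter fun u => u ∉ verticalLabels H U D l w ∧
    ∃ v, (v, w) ∈ D ∧ l (v, w) = u).card = e at *
  rw [mul_left_comm] at hsumB
  generalize Λ.card * A.card = a at *
  generalize Λ.card * L.card = d at *
  obtain ⟨m, rfl⟩ := Nat.exists_eq_add_of_le' hm
  refine le_of_mul_le_mul_left (a := m + 1) ?_ m.succ_pos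
  nlinarith [Nat.mul_le_mul_left ((m + 1) * (m + 2)) hsummiss, Nat.mul_le_mul_left (m + 2) hswap,
    Nat.mul_le_mul_left (m + 1) hsumB, Nat.mul_le_mul_left ((m + 1) * (m + 1)) hsumlayer]

open scoped Classical in
/-- Graphs of maximum degree at most `m` satisfy Vizing's inequality up to the factor
`(m + 1) / (2 * m + 1)`. -/
theorem mul_domNum_mul_domNum_le_of_degree_le [Fintype V] [Fintype W] {m : ℕ} (hm : 1 ≤ m)
    (hdeg : ∀ v, (Finset.univ.filter (G.Adj v)).card ≤ m) :
    (m + 1) * (domNum G * domNum H) ≤ (2 * m + 1) * domNum (G □ H) := by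
  obtain ⟨U, hUcard, hU⟩ := exists_isDomSet_card_eq G
  obtain ⟨D, hDcard, hD⟩ := exists_isDomSet_card_eq (G □ H)
  have hne : (Fintype.piFinset fun p : V × W => labels G U p.1).Nonempty :=
    Fintype.piFinset_nonempty.mpr fun p => labels_nonempty hU p.1
  have hfib : ∑ w, (Finset.univ.filter fun v => (v, w) ∈ D).card = D.card := by
    rw [Finset.card_eq_sum_card_fiberwise (f := Prod.snd) (t := Finset.univ) (by simp)]
    refine Finset.sum_congr rfl fun w _ => Finset.card_bij (fun v _ => (v, w)) ?_ ?_ ?_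
    · simp
    · simp
    · rintro ⟨v, w'⟩ h
      simp only [Finset.mem_filter] at h
      obtain ⟨h, rfl⟩ := h
      exact ⟨v, by simpa using h, rfl⟩
  obtain ⟨l, hl, hle⟩ : ∃ l ∈ Fintype.piFinset fun p : V × W => labels G U p.1,
      (m + 1) * ∑ w, (missingLabels H U D l w).card ≤ m * D.card := by
    refine Finset.exists_le_of_sum_le hne ?_
    have h := Finset.sum_le_sum fun w (_ : w ∈ Finset.univ) =>
      sum_card_missingLabels_le (H := H) hm hdeg hUcard hD w
    rw [← Finset.mul_sum, ← Finset.mul_sum, ← Finset.mul_sum, hfib, Finset.sum_comm] at h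
    rw [← Finset.mul_sum, Finset.sum_const, smul_eq_mul]
    exact h.trans_eq (mul_left_comm _ _ _)
  have h := domNum_mul_card_le (H := H) (D := D) (Fintype.mem_piFinset.mp hl)
  rw [← hUcard, ← hDcard]
  nlinarith [Nat.mul_le_mul_left (m + 1) h]

end Labelling

theorem stmt_4 {V W : Type*} [Fintype V] [Fintype W] (G : SimpleGraph V) (hconn : G.Connected)
    (r : ℕ) (hr : 1 < r)
    (htriangle : IsFree G (⊤ : SimpleGraph (Fin 3)))
    (hstar : IsFree G (completeBipartiteGraph (Fin 1) (Fin r))) (H : SimpleGraph W) :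
    ((r : ℝ) / (2 * r - 1)) * domNum G * domNum H ≤ domNum (G □ H) := by
  obtain ⟨m, rfl⟩ := Nat.exists_eq_add_of_lt hr
  have h := mul_domNum_mul_domNum_le_of_degree_le (H := H) (Nat.le_add_left 1 m) fun v =>
    Nat.le_of_lt_succ ((card_neighbors_lt_of_isFree htriangle hstar v).trans_eq (by omega))
  have h' : ((m : ℝ) + 1 + 1) * (domNum G * domNum H) ≤ (2 * (m + 1) + 1) * domNum (G □ H) := by
    exact_mod_cast h
  rw [div_mul_eq_mul_div, div_mul_eq_mul_div,
    div_le_iff₀ (by push_cast; linarith [m.cast_nonneg (α := ℝ)])]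
  push_cast
  linarith
end
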